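/- Let R be a commutative ring and M a flat R-module. Then for every n ≥ 0 the symmetric power Sym^n_R(M) is a flat R-module. -/

import Mathlib

open scoped TensorProduct

/-- The submodule of relations defining the `n`-th symmetric power: the span of
all elements `y - σ·y` for permutations `σ` acting on the `n`-fold tensor
power. -/
noncomputable def symRel (R M : Type*) [CommRing R] [AddCommGroup M] [Module R M]
    (n : ℕ) : Submodule R (⨂[R] (_ : Fin n), M) :=
  Submodule.span R {x | ∃ (σ : Equiv.Perm (Fin n)) (y : ⨂[R] (_ : Fin n), M),
    x = y - PiTensorProduct.reindex R (fun _ => M) σ y}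

section Aux

variable {R M N P : Type*} [CommRing R] [AddCommGroup M] [Module R M]
  [AddCommGroup N] [Module R N] [AddCommGroup P] [Module R P]

/-- The map induced on tensor powers. -/
noncomputable abbrev tMap (n : ℕ) (φ : M →ₗ[R] N) :
    (⨂[R] (_ : Fin n), M) →ₗ[R] (⨂[R] (_ : Fin n), N) :=
  PiTensorProduct.map (fun _ => φ)

theorem tMap_reindex (n : ℕ) (φ : M →ₗ[R] N) (σ : Equiv.Perm (Fin n))
    (y : ⨂[R] (_ : Fin n), M) :
    tMap n φ (PiTensorProduct.reindex R (fun _ => M) σ y) =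
      PiTensorProduct.reindex R (fun _ => N) σ (tMap n φ y) :=
  PiTensorProduct.map_reindex (fun _ => φ) σ y

theorem symRel_le_comap (n : ℕ) (φ : M →ₗ[R] N) :
    symRel R M n ≤ (symRel R N n).comap (tMap n φ) := by
  unfold symRel
  rw [Submodule.span_le]
  rintro _ ⟨σ, y, rfl⟩
  apply Submodule.subset_span
  refine ⟨σ, tMap n φ y, ?_⟩
  rw [map_sub, tMap_reindex]

/-- The map induced on symmetric powers. -/
noncomputable def sMap (n : ℕ) (φ : M →ₗ[R] N) :
    ((⨂[R] (_ : Fin n), M) ⧸ symRel R M n) →ₗ[R] ((⨂[R] (_ : Fin n), N) ⧸ symRel R N n) :=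
  Submodule.mapQ _ _ (tMap n φ) (symRel_le_comap n φ)

theorem sMap_mk (n : ℕ) (φ : M →ₗ[R] N) (z : ⨂[R] (_ : Fin n), M) :
    sMap n φ ((symRel R M n).mkQ z) = (symRel R N n).mkQ (tMap n φ z) := rfl

theorem tMap_surjective (n : ℕ) (φ : M →ₗ[R] N) (h : Function.Surjective φ) :
    Function.Surjective (tMap n φ) := by
  rw [← LinearMap.range_eq_top, eq_top_iff, ← PiTensorProduct.span_tprod_eq_top,
    Submodule.span_le]
  rintro _ ⟨v, rfl⟩
  refine ⟨PiTensorProduct.tprod R (fun i => (h (v i)).choose), ?_⟩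
  rw [PiTensorProduct.map_tprod]
  congr 1
  funext i
  exact (h (v i)).choose_spec

theorem multilinear_congr {n : ℕ} (Φ : MultilinearMap R (fun _ : Fin n => P) N) (π : P →ₗ[R] M)
    (h : ∀ p : Fin n → P, (∃ i, π (p i) = 0) → Φ p = 0) (p q : Fin n → P)
    (hpq : ∀ i, π (p i) = π (q i)) : Φ p = Φ q := by
  classical
  have key : ∀ s : Finset (Fin n), Φ (s.piecewise p q) = Φ q := by
    intro s
    induction s using Finset.induction_on with
    | empty => simp
    | insert i s hi ih =>
      rw [Finset.piecewise_insert, ← ih, ← sub_eq_zero]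
      conv_lhs => rw [← Function.update_eq_self i (s.piecewise p q)]
      rw [Function.update_idem, ← Φ.map_update_sub]
      apply h
      refine ⟨i, ?_⟩
      simp [hi, hpq]
  simpa using key Finset.univ

/-- The obvious elements in the kernel. -/
def kerGen (n : ℕ) (π : P →ₗ[R] M) : Set (⨂[R] (_ : Fin n), P) :=
  {x | ∃ p : Fin n → P, (∃ i, π (p i) = 0) ∧ x = PiTensorProduct.tprod R p}

theorem ker_tMap_le (n : ℕ) (π : P →ₗ[R] M) (hπ : Function.Surjective π) :
    LinearMap.ker (tMap n π) ≤ Submodule.span R (kerGen n π) := by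
  set K := Submodule.span R (kerGen n π) with hK
  let Φ : MultilinearMap R (fun _ : Fin n => P) ((⨂[R] (_ : Fin n), P) ⧸ K) :=
    K.mkQ.compMultilinearMap (PiTensorProduct.tprod R)
  have h0 : ∀ p : Fin n → P, (∃ i, π (p i) = 0) → Φ p = 0 := by
    intro p hp
    change K.mkQ (PiTensorProduct.tprod R p) = 0
    rw [Submodule.mkQ_apply, Submodule.Quotient.mk_eq_zero]
    exact Submodule.subset_span ⟨p, hp, rfl⟩
  choose s hs using hπ
  let Ψ : MultilinearMap R (fun _ : Fin n => M) ((⨂[R] (_ : Fin n), P) ⧸ K) :=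
    { toFun := fun m => Φ (fun i => s (m i))
      map_update_add' := by
        intro _ m i x y
        have e : ∀ z, Φ (fun j => s (Function.update m i z j)) =
            Φ (Function.update (fun j => s (m j)) i (s z)) := by
          intro z
          congr 1
          funext j
          by_cases hj : j = i
          · subst hj; simp
          · simp [hj]
        rw [e, e, e, ← Φ.map_update_add]
        apply multilinear_congr Φ π h0
        intro j
        by_cases hj : j = i
        · subst hj; simp [hs]
        · simp [hj]
      map_update_smul' := by
        intro _ m i c x
        have e : ∀ z, Φ (fun j => s (Function.update m i z j)) =
            Φ (Function.update (fun j => s (m j)) i (s z)) := by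
          intro z
          congr 1
          funext j
          by_cases hj : j = i
          · subst hj; simp
          · simp [hj]
        rw [e, e, ← Φ.map_update_smul]
        apply multilinear_congr Φ π h0
        intro j
        by_cases hj : j = i
        · subst hj; simp [hs]
        · simp [hj] }
  have hcomp : (PiTensorProduct.lift Ψ) ∘ₗ tMap n π = K.mkQ := by
    apply PiTensorProduct.ext
    ext p
    simp only [LinearMap.compMultilinearMap_apply, LinearMap.comp_apply,
      PiTensorProduct.map_tprod, PiTensorProduct.lift.tprod]
    change Φ (fun i => s (π (p i))) = Φ p
    apply multilinear_congr Φ π h0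
    intro i
    rw [hs]
  intro z hz
  rw [LinearMap.mem_ker] at hz
  have := LinearMap.congr_fun hcomp z
  rw [LinearMap.comp_apply, hz, map_zero] at this
  rw [← Submodule.Quotient.mk_eq_zero, ← Submodule.mkQ_apply, ← this]

theorem mem_sup_of_map_mem (n : ℕ) (π : P →ₗ[R] M) (hπ : Function.Surjective π)
    (z : ⨂[R] (_ : Fin n), P) (hz : tMap n π z ∈ symRel R M n) :
    ∃ w ∈ symRel R P n, z - w ∈ Submodule.span R (kerGen n π) := by
  have hle : symRel R M n ≤ (symRel R P n).map (tMap n π) := by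
    conv_lhs => unfold symRel
    rw [Submodule.span_le]
    rintro _ ⟨σ, y, rfl⟩
    obtain ⟨y, rfl⟩ := tMap_surjective n π hπ y
    refine ⟨y - PiTensorProduct.reindex R (fun _ => P) σ y,
      Submodule.subset_span ⟨σ, y, rfl⟩, ?_⟩
    rw [map_sub, tMap_reindex]
  obtain ⟨w, hw, hwz⟩ := hle hz
  refine ⟨w, hw, ker_tMap_le n π hπ ?_⟩
  rw [LinearMap.mem_ker, map_sub, hwz, sub_self]

theorem exists_kill [Module.Flat R M] {ι : Type*} (π : (ι →₀ R) →ₗ[R] M) (S : Finset (ι →₀ R))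
    (hS : ∀ k ∈ S, π k = 0) :
    ∃ (l : ℕ) (φ : (ι →₀ R) →ₗ[R] ((Fin l →₀ R) × (ι →₀ R)))
      (g : ((Fin l →₀ R) × (ι →₀ R)) →ₗ[R] M),
      g ∘ₗ φ = π ∧ ∀ k ∈ S, φ k = 0 := by
  classical
  let A : Finset ι := S.biUnion Finsupp.support
  let j : (A →₀ R) →ₗ[R] (ι →₀ R) := Finsupp.lmapDomain R R Subtype.val
  let r : (ι →₀ R) →ₗ[R] (A →₀ R) := Finsupp.lcomapDomain Subtype.val Subtype.val_injective
  have hjr : ∀ k ∈ S, j (r k) = k := by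
    intro k hk
    change Finsupp.mapDomain Subtype.val (Finsupp.comapDomain Subtype.val k _) = k
    apply Finsupp.mapDomain_comapDomain _ Subtype.val_injective
    intro i hi
    exact ⟨⟨i, Finset.mem_biUnion.2 ⟨k, hk, hi⟩⟩, rfl⟩
  let K : Submodule R (A →₀ R) := Submodule.span R ((S.image r : Finset _) : Set (A →₀ R))
  have hfin : Module.Finite R K := Module.Finite.span_finset R _
  have hle : K ≤ LinearMap.ker (π ∘ₗ j) := by
    rw [Submodule.span_le]
    intro x hx
    obtain ⟨k, hk, rfl⟩ := Finset.mem_image.1 (Finset.mem_coe.1 hx)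
    simp [hjr k hk, hS k hk]
  obtain ⟨l, a, y, hya, haf⟩ := Module.Flat.exists_factorization_of_comp_eq_zero_of_free
    (K := K) (f := K.subtype) (x := π ∘ₗ j) (LinearMap.ext fun x => hle x.2)
  refine ⟨l, (a ∘ₗ r).prod (LinearMap.id - j ∘ₗ r), y.coprod π, ?_, ?_⟩
  · apply LinearMap.ext
    intro p
    have := LinearMap.congr_fun hya (r p)
    simp only [LinearMap.comp_apply] at this
    simp [← this]
  · intro k hk
    have hk' : r k ∈ K := Submodule.subset_span (by simpa using ⟨k, hk, rfl⟩)
    have := LinearMap.congr_fun haf ⟨r k, hk'⟩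
    simp only [LinearMap.comp_apply, Submodule.subtype_apply, LinearMap.zero_apply] at this
    simp [this, hjr k hk]

theorem mk_tprod_perm (n : ℕ) (v : Fin n → M) (σ : Equiv.Perm (Fin n)) :
    (symRel R M n).mkQ (PiTensorProduct.tprod R (v ∘ σ)) =
      (symRel R M n).mkQ (PiTensorProduct.tprod R v) := by
  rw [← sub_eq_zero, ← map_sub, Submodule.mkQ_apply, Submodule.Quotient.mk_eq_zero]
  refine Submodule.subset_span ⟨σ, PiTensorProduct.tprod R (v ∘ σ), ?_⟩
  rw [PiTensorProduct.reindex_tprod]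
  congr 2
  funext i
  simp

theorem exists_perm_of_sum_single {ι : Type*} (n : ℕ) (v w : Fin n → ι)
    (h : ∑ i, Finsupp.single (v i) 1 = ∑ i, Finsupp.single (w i) (1 : ℕ)) :
    ∃ σ : Equiv.Perm (Fin n), w = v ∘ σ := by
  classical
  have hc : ∀ a, Fintype.card {i // w i = a} = Fintype.card {i // v i = a} := by
    intro a
    have := DFunLike.congr_fun h a
    simp only [Finsupp.finsetSum_apply, Finsupp.single_apply] at this
    simpa [Fintype.card_subtype] using this.symm
  let e : ∀ a, {i // w i = a} ≃ {i // v i = a} := fun a => Fintype.equivOfCardEq (hc a)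
  refine ⟨(Equiv.sigmaFiberEquiv w).symm.trans
    ((Equiv.sigmaCongrRight e).trans (Equiv.sigmaFiberEquiv v)), ?_⟩
  funext i
  exact ((e (w i)) ⟨i, rfl⟩).2.symm

theorem flat_of_basis {ι : Type*} (b : Module.Basis ι R M) (n : ℕ) :
    Module.Flat R ((⨂[R] (_ : Fin n), M) ⧸ symRel R M n) := by
  classical
  let L : M →ₗ[R] MvPolynomial ι R := b.constr R (fun i => MvPolynomial.X i)
  let μ : (⨂[R] (_ : Fin n), M) →ₗ[R] MvPolynomial ι R :=
    PiTensorProduct.lift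
      ((MultilinearMap.mkPiAlgebra R (Fin n) (MvPolynomial ι R)).compLinearMap (fun _ => L))
  have hμ : ∀ v, μ (PiTensorProduct.tprod R v) = ∏ i, L (v i) := by
    intro v
    simp [μ]
  have hμσ : ∀ (σ : Equiv.Perm (Fin n)) y,
      μ (PiTensorProduct.reindex R (fun _ => M) σ y) = μ y := by
    intro σ y
    have : μ ∘ₗ (PiTensorProduct.reindex R (fun _ => M) σ).toLinearMap = μ := by
      apply PiTensorProduct.ext
      ext1 v
      simp only [LinearMap.compMultilinearMap_apply, LinearMap.comp_apply,
        LinearEquiv.coe_coe, PiTensorProduct.reindex_tprod]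
      rw [hμ, hμ]
      exact Equiv.prod_comp σ.symm (fun i => L (v i))
    exact LinearMap.congr_fun this y
  have hle : symRel R M n ≤ LinearMap.ker μ := by
    unfold symRel
    rw [Submodule.span_le]
    rintro _ ⟨σ, y, rfl⟩
    simp [hμσ]
  let r : MvPolynomial ι R →ₗ[R] ((⨂[R] (_ : Fin n), M) ⧸ symRel R M n) :=
    (MvPolynomial.basisMonomials ι R).constr R (fun m =>
      if h : ∃ v : Fin n → ι, ∑ i, Finsupp.single (v i) 1 = m then
        (symRel R M n).mkQ (PiTensorProduct.tprod R (b ∘ h.choose)) else 0)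
  refine Module.Flat.of_retract ((symRel R M n).liftQ μ hle) r ?_
  apply Submodule.linearMap_qext
  apply PiTensorProduct.ext
  apply Module.Basis.ext_multilinear (fun _ => b)
  intro v
  simp only [LinearMap.compMultilinearMap_apply, LinearMap.comp_apply, Submodule.mkQ_apply,
    Submodule.liftQ_apply, LinearMap.id_apply]
  rw [hμ]
  have h1 : ∏ i, L (b (v i)) =
      MvPolynomial.basisMonomials ι R (∑ i, Finsupp.single (v i) 1) := by
    simp only [L, Module.Basis.constr_basis, MvPolynomial.coe_basisMonomials]
    rw [MvPolynomial.monomial_sum_one]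
    rfl
  rw [h1]
  have hex : ∃ w : Fin n → ι, ∑ i, Finsupp.single (w i) 1 =
      ∑ i, Finsupp.single (v i) (1 : ℕ) := ⟨v, rfl⟩
  simp only [r]
  rw [Module.Basis.constr_basis, dif_pos hex]
  obtain ⟨σ, hσ⟩ := exists_perm_of_sum_single n v hex.choose hex.choose_spec.symm
  rw [hσ, ← Function.comp_assoc, mk_tprod_perm]
  rfl

theorem sum_mk_eq_zero (n : ℕ) {l : ℕ} (φ : M →ₗ[R] N) (f : Fin l → R)
    (z : Fin l → ⨂[R] (_ : Fin n), M) (h : tMap n φ (∑ i, f i • z i) ∈ symRel R N n) :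
    ∑ i, f i • (symRel R N n).mkQ (tMap n φ (z i)) = 0 := by
  rw [← Submodule.Quotient.mk_eq_zero, ← Submodule.mkQ_apply, map_sum, map_sum] at h
  simpa only [map_smul] using h

theorem tMap_tMap (n : ℕ) (φ : M →ₗ[R] N) (g : N →ₗ[R] P) (z : ⨂[R] (_ : Fin n), M) :
    tMap n g (tMap n φ z) = tMap n (g ∘ₗ φ) z := by
  unfold tMap
  rw [PiTensorProduct.map_comp, LinearMap.comp_apply]

end Aux

/-- Symmetric powers of a flat module are flat. -/
theorem symmetricPower_flat {R M : Type*} [CommRing R] [AddCommGroup M] [Module R M]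
    [Module.Flat R M] (n : ℕ) :
    Module.Flat R ((⨂[R] (_ : Fin n), M) ⧸ symRel R M n) := by
  classical
  apply Module.Flat.of_forall_isTrivialRelation
  intro l f x hx
  let π : (M →₀ R) →ₗ[R] M := Finsupp.linearCombination R id
  have hπ : Function.Surjective π := Finsupp.linearCombination_id_surjective R M
  have hsurj : ∀ i, ∃ z, (symRel R M n).mkQ (tMap n π z) = x i := by
    intro i
    obtain ⟨t, ht⟩ := (symRel R M n).mkQ_surjective (x i)
    obtain ⟨z, rfl⟩ := tMap_surjective n π hπ t
    exact ⟨z, ht⟩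
  choose z hz using hsurj
  have hmem : tMap n π (∑ i, f i • z i) ∈ symRel R M n := by
    rw [← Submodule.Quotient.mk_eq_zero, ← Submodule.mkQ_apply, map_sum, map_sum, ← hx]
    simp only [map_smul, hz]
  obtain ⟨w, hw, hzw⟩ := mem_sup_of_map_mem n π hπ _ hmem
  obtain ⟨T, hT, hzT⟩ := Submodule.mem_span_finite_of_mem_span hzw
  have hT' : ∀ t : T, ∃ k : M →₀ R, π k = 0 ∧ ∃ p : Fin n → (M →₀ R), (∃ i, p i = k) ∧
      t.1 = PiTensorProduct.tprod R p := by
    intro t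
    obtain ⟨p, ⟨i, hi⟩, ht⟩ := hT t.2
    exact ⟨p i, hi, p, ⟨i, rfl⟩, ht⟩
  choose k hk p hp hpt using hT'
  obtain ⟨d, φ, g, hg, hφ⟩ := exists_kill π (Finset.univ.image k) (by
    intro y hy
    obtain ⟨t, -, rfl⟩ := Finset.mem_image.1 hy
    exact hk t)
  have hker : Submodule.span R (T : Set (⨂[R] (_ : Fin n), (M →₀ R))) ≤
      LinearMap.ker (tMap n φ) := by
    rw [Submodule.span_le]
    intro t ht
    obtain ⟨i, hi⟩ := hp ⟨t, ht⟩
    have h1 := hpt ⟨t, ht⟩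
    simp only at h1
    rw [SetLike.mem_coe, LinearMap.mem_ker, h1, PiTensorProduct.map_tprod]
    apply MultilinearMap.map_coord_zero _ i
    rw [hi]
    exact hφ _ (Finset.mem_image_of_mem _ (Finset.mem_univ _))
  have hzero : ∑ i, f i • (symRel R ((Fin d →₀ R) × (M →₀ R)) n).mkQ (tMap n φ (z i)) = 0 := by
    have h2 : tMap n φ (∑ i, f i • z i) ∈ symRel R ((Fin d →₀ R) × (M →₀ R)) n := by
      have h3 := hker hzT
      rw [LinearMap.mem_ker, map_sub, sub_eq_zero] at h3
      rw [h3]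
      exact symRel_le_comap n φ hw
    exact sum_mk_eq_zero n φ f z h2
  have hflat := flat_of_basis (Module.Free.chooseBasis R ((Fin d →₀ R) × (M →₀ R))) n
  obtain ⟨q, a, y, hy, ha⟩ := Module.Flat.isTrivialRelation_of_sum_smul_eq_zero hzero
  refine ⟨q, a, fun j => sMap n g (y j), ?_, ha⟩
  intro i
  have h4 := congrArg (sMap n g) (hy i)
  have h5 := sMap_mk n g (tMap n φ (z i))
  rw [tMap_tMap, hg] at h5
  replace h4 := h5.symm.trans h4
  rw [← hz i]
  simpa only [map_sum, map_smul] using h4
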